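/- arXiv:1604.07035 — 2 statements merged into one kernel-verified Lean document; each statement's English description precedes it below -/
import Mathlib

section
/- Let V_1 and V_2 be disjoint vertex sets with |V_1| = n_1 and |V_2| = n_2, let H_1 be an inclusion-free hypergraph on V_1 and H_2 an inclusion-free hypergraph on V_2, and let H = H_1 ⊔ H_2 be their disjoint union on V_1 ∪ V_2. Then for every strictly increasing f: [M] → ℝ with positive values, |Z_1(H, M, f)| ≥ (M−1)^{n_2}·|Z_1(H_1, M, f)| + (M−1)^{n_1}·|Z_1(H_2, M, f)|. -/
open Finset

/-- The weight of an edge `e` under vertex-weight function `w` and objective function `f`: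
`fw(e) = ∑_{i ∈ e} f(w(i))`. -/
def edgeW {V : Type*} (f : ℕ → ℝ) (w : V → ℕ) (e : Finset V) : ℝ :=
  ∑ i ∈ e, f (w i)

/-- A hypergraph is inclusion-free if no edge is a proper subset of another edge. -/
def InclFree {V : Type*} (H : Finset (Finset V)) : Prop :=
  ∀ e ∈ H, ∀ e' ∈ H, ¬ e ⊂ e'

/-- `f` is an objective function for `[M]`: strictly increasing with strictly positive
values on `{1, …, M}`. -/
def Objective (M : ℕ) (f : ℕ → ℝ) : Prop :=
  StrictMonoOn f (Set.Icc 1 M) ∧ ∀ i ∈ Set.Icc 1 M, (0 : ℝ) < f i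

/-- `w` is isolating for `H, f`: there is exactly one edge `e ∈ H` with
`fw(e) < fw(e')` for all edges `e' ≠ e`.  By convention every weight is isolating
for the empty hypergraph. -/
def Isolating {V : Type*} (H : Finset (Finset V)) (f : ℕ → ℝ) (w : V → ℕ) : Prop :=
  H = ∅ ∨ ∃! e, e ∈ H ∧ ∀ e' ∈ H, e' ≠ e → edgeW f w e < edgeW f w e'

/-- `Z(H, M, f)`: the set of isolating weights `w : V → {1, …, M}`. -/
def Zset {V : Type*} (M : ℕ) (H : Finset (Finset V)) (f : ℕ → ℝ) : Set (V → ℕ) :=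
  {w | (∀ i, 1 ≤ w i ∧ w i ≤ M) ∧ Isolating H f w}

/-- `Z_j(H, M, f)`: the set of isolating weights `w ∈ [M]^V` whose minimum entry
(layer) equals `j`. -/
def Zlayer {V : Type*} (M j : ℕ) (H : Finset (Finset V)) (f : ℕ → ℝ) : Set (V → ℕ) :=
  {w | w ∈ Zset M H f ∧ (∀ i, j ≤ w i) ∧ ∃ i, w i = j}

section Isolation

variable {V : Type*} {M : ℕ} {f : ℕ → ℝ}

/-- `e` is the edge selected by `w`: the unique edge of minimum weight, or the empty set if
there are no edges. -/
def IsSelected (H : Finset (Finset V)) (f : ℕ → ℝ) (w : V → ℕ) (e : Finset V) : Prop :=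
  (H = ∅ ∧ e = ∅) ∨ (e ∈ H ∧ ∀ e' ∈ H, e' ≠ e → edgeW f w e < edgeW f w e')

theorem isolating_iff_exists_isSelected {H : Finset (Finset V)} {w : V → ℕ} :
    Isolating H f w ↔ ∃ e, IsSelected H f w e := by
  constructor
  · rintro (h | ⟨e, he, -⟩)
    · exact ⟨∅, Or.inl ⟨h, rfl⟩⟩
    · exact ⟨e, Or.inr he⟩
  · rintro ⟨e, ⟨h, -⟩ | ⟨he, hmin⟩⟩
    · exact Or.inl h
    · refine Or.inr ⟨e, ⟨he, hmin⟩, fun e' ⟨he', hmin'⟩ => ?_⟩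
      by_contra hne
      exact lt_asymm (hmin e' he' hne) (hmin' e he (Ne.symm hne))

theorem IsSelected.unique {H : Finset (Finset V)} {w : V → ℕ} {e e' : Finset V}
    (h : IsSelected H f w e) (h' : IsSelected H f w e') : e = e' := by
  rcases h with ⟨hH, rfl⟩ | ⟨he, hmin⟩ <;> rcases h' with ⟨hH', rfl⟩ | ⟨he', hmin'⟩
  · rfl
  · simp [hH] at he'
  · simp [hH'] at he
  · by_contra hne
    exact lt_asymm (hmin e' he' (Ne.symm hne)) (hmin' e he hne)

theorem InclFree.image_map {W : Type*} [DecidableEq W] {H : Finset (Finset V)} (hH : InclFree H)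
    (φ : V ↪ W) : InclFree (H.image fun e => e.map φ) := by
  intro e he e' he' hlt
  obtain ⟨a, ha, rfl⟩ := mem_image.1 he
  obtain ⟨b, hb, rfl⟩ := mem_image.1 he'
  exact hH a ha b hb (by simpa using hlt)

theorem edgeW_map {W : Type*} (φ : V ↪ W) (w : W → ℕ) (e : Finset V) :
    edgeW f w (e.map φ) = edgeW f (w ∘ φ) e := by
  simp [edgeW]

theorem IsSelected.image_map {W : Type*} [DecidableEq W] {H : Finset (Finset V)} {φ : V ↪ W}
    {w : W → ℕ} {e : Finset V} (h : IsSelected H f (w ∘ φ) e) :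
    IsSelected (H.image fun e => e.map φ) f w (e.map φ) := by
  rcases h with ⟨rfl, rfl⟩ | ⟨he, hmin⟩
  · exact Or.inl ⟨by simp, by simp⟩
  · refine Or.inr ⟨mem_image_of_mem _ he, fun e' he' hne => ?_⟩
    obtain ⟨a, ha, rfl⟩ := mem_image.1 he'
    rw [edgeW_map, edgeW_map]
    exact hmin a ha fun h => hne (by rw [h])

theorem Isolating.image_map {W : Type*} [DecidableEq W] {H : Finset (Finset V)} {φ : V ↪ W}
    {w : W → ℕ} (h : Isolating H f (w ∘ φ)) :
    Isolating (H.image fun e => e.map φ) f w := by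
  obtain ⟨e, he⟩ := isolating_iff_exists_isSelected.1 h
  exact isolating_iff_exists_isSelected.2 ⟨_, he.image_map⟩

theorem edgeW_pos (hf : Objective M f) {w : V → ℕ} (hw : ∀ i, 1 ≤ w i ∧ w i ≤ M)
    {e : Finset V} (he : e.Nonempty) : 0 < edgeW f w e :=
  sum_pos (fun i _ => hf.2 _ (hw i)) he

theorem Zlayer_finite [Finite V] (j : ℕ) (H : Finset (Finset V)) :
    (Zlayer M j H f).Finite := by
  refine (Set.Finite.pi fun _ : V => Set.finite_Iic M).subset fun w hw => ?_
  exact fun i _ => (hw.1.1 i).2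

variable [DecidableEq V]

/-- The weight obtained from `w` by subtracting one on `T`. -/
def lowerOn (w : V → ℕ) (T : Finset V) : V → ℕ := fun i => if i ∈ T then w i - 1 else w i

theorem edgeW_lowerOn_of_disjoint {w : V → ℕ} {e T : Finset V} (h : Disjoint e T) :
    edgeW f (lowerOn w T) e = edgeW f w e :=
  sum_congr rfl fun i hi => by simp [lowerOn, disjoint_left.1 h hi]

theorem Objective.lt_pred (hf : Objective M f) {n : ℕ} (h2 : 2 ≤ n) (hM : n ≤ M) :
    f (n - 1) < f n :=
  hf.1 ⟨by omega, by omega⟩ ⟨by omega, hM⟩ (by omega)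

theorem edgeW_lowerOn_lt (hf : Objective M f) {w : V → ℕ} (hM : ∀ i, w i ≤ M)
    {e e' : Finset V} (h2 : ∀ i ∈ e, 2 ≤ w i) (hle : edgeW f w e ≤ edgeW f w e')
    (hsub : ¬ e ⊆ e') : edgeW f (lowerOn w e) e < edgeW f (lowerOn w e) e' := by
  have key (s : Finset V) : edgeW f (lowerOn w e) s
      = edgeW f w s - ∑ i ∈ s ∩ e, (f (w i) - f (w i - 1)) := by
    rw [edgeW, edgeW, ← sum_ite_mem, ← sum_sub_distrib]
    refine sum_congr rfl fun i _ => ?_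
    by_cases hi : i ∈ e <;> simp [lowerOn, hi]
  have hlt : ∑ i ∈ e' ∩ e, (f (w i) - f (w i - 1)) < ∑ i ∈ e ∩ e, (f (w i) - f (w i - 1)) := by
    obtain ⟨j, hj, hj'⟩ := not_subset.1 hsub
    rw [inter_self]
    refine sum_lt_sum_of_subset inter_subset_right hj (by simp [hj'])
      (sub_pos.2 (hf.lt_pred (h2 j hj) (hM j))) fun i hi _ =>
      (sub_pos.2 (hf.lt_pred (h2 i hi) (hM i))).le
  rw [key, key]
  linarith

theorem exists_isSelected_lowerOn (hf : Objective M f) {K L : Finset (Finset V)} {S : Finset V}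
    (hK : ∀ e ∈ K, Disjoint e S) (hL : ∀ e ∈ L, e ⊆ S) (hLfree : InclFree L) {w : V → ℕ}
    (hw : ∀ i, 1 ≤ w i ∧ w i ≤ M) (hS : ∀ i ∈ S, 2 ≤ w i) (hiso : Isolating K f w) :
    ∃ e, IsSelected (K ∪ L) f (lowerOn w (e ∩ S)) e := by
  have lower_empty : lowerOn w ∅ = w := by ext; simp [lowerOn]
  obtain ⟨a, ha⟩ := isolating_iff_exists_isSelected.1 hiso
  have haS : a ∩ S = ∅ := by
    rcases ha with ⟨-, rfl⟩ | ⟨ha, -⟩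
    · simp
    · exact disjoint_iff_inter_eq_empty.1 (hK a ha)
  rcases L.eq_empty_or_nonempty with rfl | hne
  · exact ⟨a, by rwa [union_empty, haS, lower_empty]⟩
  obtain ⟨b, hb, hbmin⟩ := exists_min_image L (edgeW f w) hne
  by_cases hab : a ∈ K ∧ edgeW f w a < edgeW f w b
  · refine ⟨a, Or.inr ⟨mem_union_left _ hab.1, fun e' he' hne' => ?_⟩⟩
    rw [haS, lower_empty]
    rcases mem_union.1 he' with he' | he'
    · rcases ha with ⟨rfl, -⟩ | ⟨-, hmin⟩
      · simp at he'
      · exact hmin e' he' hne'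
    · exact hab.2.trans_le (hbmin e' he')
  refine ⟨b, Or.inr ⟨mem_union_right _ hb, fun e' he' hne' => ?_⟩⟩
  rw [inter_eq_left.2 (hL b hb)]
  have hlt := edgeW_lowerOn_lt (e := b) (e' := e') hf (fun i => (hw i).2)
    fun i hi => hS i (hL b hb hi)
  rcases mem_union.1 he' with he' | he'
  · rcases b.eq_empty_or_nonempty with rfl | hbne
    · rw [lower_empty]
      simpa [edgeW] using edgeW_pos hf hw (nonempty_iff_ne_empty.2 hne')
    · refine hlt ?_ fun hsub => ?_
      · rcases ha with ⟨rfl, -⟩ | ⟨ha, hmin⟩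
        · simp at he'
        · have hba : edgeW f w b ≤ edgeW f w a := not_lt.1 fun h => hab ⟨ha, h⟩
          by_cases h : e' = a
          · rwa [h]
          · exact hba.trans (hmin e' he' h).le
      · obtain ⟨i, hi⟩ := hbne
        exact disjoint_left.1 (hK e' he') (hsub hi) (hL b hb hi)
  · exact hlt (hbmin e' he') fun hsub => hLfree b hb e' he' (hsub.ssubset_of_ne hne'.symm)

/-- Weights in `[M]^V` which are at least two on `S`, take the value one outside `S`, and
become isolating after lowering the part inside `S` of the edge that is then selected. -/
def lowerable (M : ℕ) (H : Finset (Finset V)) (f : ℕ → ℝ) (S : Finset V) : Set (V → ℕ) :=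
  {w | (∀ i, 1 ≤ w i ∧ w i ≤ M) ∧ (∀ i ∈ S, 2 ≤ w i) ∧ (∃ i ∉ S, w i = 1) ∧
    ∃ e, IsSelected H f (lowerOn w (e ∩ S)) e}

theorem lowerOn_mem_Zlayer {H : Finset (Finset V)} {S e : Finset V} {w : V → ℕ}
    (hw : w ∈ lowerable M H f S) (he : IsSelected H f (lowerOn w (e ∩ S)) e) :
    lowerOn w (e ∩ S) ∈ Zlayer M 1 H f := by
  obtain ⟨hb, hS, ⟨j, hjS, hj⟩, -⟩ := hw
  have hb' (i : V) : 1 ≤ lowerOn w (e ∩ S) i ∧ lowerOn w (e ∩ S) i ≤ M := by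
    have := hb i
    by_cases hi : i ∈ e ∩ S
    · have := hS i (mem_inter.1 hi).2
      simp only [lowerOn, hi, if_true]
      omega
    · simpa only [lowerOn, hi, if_false]
  exact ⟨⟨hb', isolating_iff_exists_isSelected.2 ⟨e, he⟩⟩, fun i => (hb' i).1, j,
    by simp [lowerOn, hjS, hj]⟩

theorem lowerOn_inj {S T : Finset V} {v w : V → ℕ} (hTS : T ⊆ S) (hv : ∀ i ∈ S, 2 ≤ v i)
    (hw : ∀ i ∈ S, 2 ≤ w i) (h : lowerOn v T = lowerOn w T) : v = w := by
  ext i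
  have hi := congrFun h i
  by_cases hT : i ∈ T
  · have := hv i (hTS hT)
    have := hw i (hTS hT)
    simp only [lowerOn, hT, if_true] at hi
    omega
  · simpa only [lowerOn, hT, if_false] using hi

theorem exists_mem_of_lowerOn_eq {S T e : Finset V} {v w : V → ℕ}
    (hvS : ∀ i ∈ S, 2 ≤ v i) (hw : ∃ i ∈ S, w i = 1)
    (h : lowerOn v (e ∩ S) = lowerOn w (e ∩ T)) : ∃ i ∈ e, i ∈ S := by
  obtain ⟨i, hi, hwi⟩ := hw
  refine ⟨i, ?_, hi⟩
  by_contra hie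
  have := congrFun h i
  have := hvS i hi
  simp_all [lowerOn]

theorem ncard_lowerable_add_le [Finite V] {H : Finset (Finset V)} {S T : Finset V}
    (hST : IsCompl (S : Set V) T) (hH : ∀ e ∈ H, e ⊆ S ∨ e ⊆ T) :
    (lowerable M H f S).ncard + (lowerable M H f T).ncard ≤ (Zlayer M 1 H f).ncard := by
  classical
  have hdisj : Disjoint S T := by exact_mod_cast hST.disjoint
  have hcov (i : V) : i ∈ S ∨ i ∈ T := by
    have : i ∈ (S : Set V) ∪ T := hST.sup_eq_top.ge (Set.mem_univ i)
    simpa using this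
  have hsel (S : Finset V) (w : V → ℕ) : ∃ e, w ∈ lowerable M H f S →
      IsSelected H f (lowerOn w (e ∩ S)) e := by
    by_cases hw : w ∈ lowerable M H f S
    · obtain ⟨e, he⟩ := hw.2.2.2
      exact ⟨e, fun _ => he⟩
    · exact ⟨∅, fun h => absurd h hw⟩
  choose sel hsel using hsel
  let g (S : Finset V) (w : V → ℕ) := lowerOn w (sel S w ∩ S)
  have hinj (S : Finset V) : Set.InjOn (g S) (lowerable M H f S) := by
    intro v hv w hw hvw
    have hev := hsel S v hv
    have hew := hsel S w hw
    simp only [g] at hvw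
    rw [hvw] at hev
    rw [hev.unique hew] at hvw
    exact lowerOn_inj inter_subset_right hv.2.1 hw.2.1 hvw
  have hsub (S : Finset V) : g S '' lowerable M H f S ⊆ Zlayer M 1 H f := by
    rintro - ⟨w, hw, rfl⟩
    exact lowerOn_mem_Zlayer hw (hsel S w hw)
  have hfin := Zlayer_finite (M := M) (f := f) 1 H
  rw [← (hinj S).ncard_image, ← (hinj T).ncard_image, ← Set.ncard_union_eq _
    (hfin.subset (hsub S)) (hfin.subset (hsub T))]
  · exact Set.ncard_le_ncard (Set.union_subset (hsub S) (hsub T)) hfin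
  rw [Set.disjoint_left]
  rintro - ⟨v, hv, rfl⟩ ⟨w, hw, hwv⟩
  have hev := hsel S v hv
  have hew := hsel T w hw
  simp only [g] at hwv
  rw [hwv] at hew
  have he := hev.unique hew
  rw [← he] at hwv
  obtain ⟨i, hiT, hvi⟩ := hv.2.2.1
  obtain ⟨j, hjS, hwj⟩ := hw.2.2.1
  obtain ⟨x, hx, hxS⟩ := exists_mem_of_lowerOn_eq hv.2.1
    ⟨j, (hcov j).resolve_right hjS, hwj⟩ hwv.symm
  obtain ⟨y, hy, hyT⟩ := exists_mem_of_lowerOn_eq hw.2.1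
    ⟨i, (hcov i).resolve_left hiT, hvi⟩ hwv
  rcases hev with ⟨-, h⟩ | ⟨hmem, -⟩
  · simp [h] at hx
  · rcases hH _ hmem with h | h
    · exact disjoint_left.1 hdisj (h hy) hyT
    · exact disjoint_left.1 hdisj hxS (h hx)

/-- Pairing weights on `ι` from a layer with weights on `κ` that avoid the value one. -/
theorem pow_mul_ncard_le_ncard_lowerable {ι κ : Type*} [Fintype κ] [Finite V]
    (hf : Objective M f) {φ : ι ↪ V} {ψ : κ ↪ V} (c : ι ⊕ κ ≃ V) (hφ : ∀ i, c (Sum.inl i) = φ i)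
    (hψ : ∀ k, c (Sum.inr k) = ψ k) {H₁ : Finset (Finset ι)} {H₂ : Finset (Finset κ)}
    (h₂ : InclFree H₂) :
    (M - 1) ^ Fintype.card κ * (Zlayer M 1 H₁ f).ncard ≤
      (lowerable M ((H₁.image fun e => e.map φ) ∪ (H₂.image fun e => e.map ψ)) f
        (univ.map ψ)).ncard := by
  classical
  let B : Finset (κ → ℕ) := Fintype.piFinset fun _ => Icc 2 M
  have hB : (B : Set (κ → ℕ)).ncard = (M - 1) ^ Fintype.card κ := by
    rw [Set.ncard_coe_finset, Fintype.card_piFinset]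
    simp
  let g : (κ → ℕ) × (ι → ℕ) → V → ℕ := fun p => Sum.elim p.2 p.1 ∘ c.symm
  have hgφ (p) (i : ι) : g p (φ i) = p.2 i := by simp [g, ← hφ]
  have hgψ (p) (k : κ) : g p (ψ k) = p.1 k := by simp [g, ← hψ]
  have hcases (x : V) : (∃ i, φ i = x) ∨ ∃ k, ψ k = x := by
    obtain ⟨y | y, rfl⟩ := c.surjective x
    · exact Or.inl ⟨y, (hφ y).symm⟩
    · exact Or.inr ⟨y, (hψ y).symm⟩
  have hne (i : ι) (k : κ) : ψ k ≠ φ i := by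
    rw [← hφ, ← hψ]
    exact fun h => Sum.inr_ne_inl (c.injective h)
  have hg : Function.Injective g := by
    intro p q hpq
    refine Prod.ext (funext fun k => ?_) (funext fun i => ?_)
    · rw [← hgψ, ← hgψ, hpq]
    · rw [← hgφ, ← hgφ, hpq]
  rw [← hB, ← Set.ncard_prod, ← Set.ncard_image_of_injective _ hg]
  refine Set.ncard_le_ncard ?_ ?_
  · rintro - ⟨⟨w₂, w₁⟩, ⟨hw₂, hw₁⟩, rfl⟩
    have hw₂ (k : κ) : 2 ≤ w₂ k ∧ w₂ k ≤ M := by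
      simpa using Fintype.mem_piFinset.1 (mem_coe.1 hw₂) k
    obtain ⟨⟨hb, hiso⟩, -, i, hi⟩ := hw₁
    have hbound (x : V) : 1 ≤ g (w₂, w₁) x ∧ g (w₂, w₁) x ≤ M := by
      rcases hcases x with ⟨i, rfl⟩ | ⟨k, rfl⟩
      · rw [hgφ]
        exact hb i
      · rw [hgψ]
        exact ⟨one_le_two.trans (hw₂ k).1, (hw₂ k).2⟩
    have htwo : ∀ x ∈ univ.map ψ, 2 ≤ g (w₂, w₁) x := by
      intro x hx
      obtain ⟨k, -, rfl⟩ := mem_map.1 hx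
      rw [hgψ]
      exact (hw₂ k).1
    refine ⟨hbound, htwo, ⟨φ i, ?_, ?_⟩, exists_isSelected_lowerOn hf ?_ ?_ (h₂.image_map ψ)
      hbound htwo (Isolating.image_map ?_)⟩
    · simpa using hne i
    · rwa [hgφ]
    · intro e he
      obtain ⟨a, -, rfl⟩ := mem_image.1 he
      rw [disjoint_left]
      intro x hx hx'
      obtain ⟨i, -, rfl⟩ := mem_map.1 hx
      obtain ⟨k, -, hk⟩ := mem_map.1 hx'
      exact hne i k hk
    · intro e he
      obtain ⟨a, -, rfl⟩ := mem_image.1 he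
      exact map_subset_map.2 (subset_univ a)
    · have : g (w₂, w₁) ∘ φ = w₁ := funext fun i => hgφ (w₂, w₁) i
      rwa [this]
  · refine (Set.Finite.pi fun _ : V => Set.finite_Iic M).subset fun w hw => ?_
    exact fun i _ => (hw.1 i).2

end Isolation

/-- Proposition 15 of the paper.  For inclusion-free hypergraphs
`H₁` on a vertex set of size `n₁` and `H₂` on a disjoint vertex set of size `n₂`,
their disjoint union `H = H₁ ⊔ H₂` satisfies
`|Z_1(H,M,f)| ≥ (M-1)^{n₂}·|Z_1(H₁,M,f)| + (M-1)^{n₁}·|Z_1(H₂,M,f)|`. -/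
theorem stmt_12 {α β : Type*} [Fintype α] [Fintype β] [DecidableEq α] [DecidableEq β]
    {M : ℕ} (H₁ : Finset (Finset α)) (H₂ : Finset (Finset β)) (f : ℕ → ℝ)
    (h₁ : InclFree H₁) (h₂ : InclFree H₂) (hf : Objective M f) :
    (M - 1) ^ Fintype.card β * (Zlayer M 1 H₁ f).ncard
        + (M - 1) ^ Fintype.card α * (Zlayer M 1 H₂ f).ncard
      ≤ (Zlayer M 1
          ((H₁.image fun e => e.map (Function.Embedding.inl (β := β))) ∪
            (H₂.image fun e => e.map (Function.Embedding.inr (α := α)))) f).ncard := by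
  refine (Nat.add_le_add
    (pow_mul_ncard_le_ncard_lowerable (φ := .inl) (ψ := .inr) hf (Equiv.refl (α ⊕ β))
      (fun _ => rfl) (fun _ => rfl) h₂)
    (pow_mul_ncard_le_ncard_lowerable (φ := .inr) (ψ := .inl) hf (Equiv.sumComm β α)
      (fun _ => rfl) (fun _ => rfl) h₁)).trans ?_
  rw [union_comm (H₂.image _)]
  refine ncard_lowerable_add_le ?_ fun e he => ?_
  · simpa using Set.isCompl_range_inl_range_inr.symm
  · rcases mem_union.1 he with he | he
    all_goals obtain ⟨a, -, rfl⟩ := mem_image.1 he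
    · exact Or.inr (map_subset_map.2 (subset_univ a))
    · exact Or.inl (map_subset_map.2 (subset_univ a))
end

section
/- For every n ≥ 2, every inclusion-free hypergraph H on [n], and every strictly increasing function f: [2] → ℝ with strictly positive values, the number of isolating weights w: [n] → {1,2} with min_i w(i) = 1 satisfies |Z_1(H, 2, f)| ≥ n. -/
open Finset

/-- The weight that is `1` on `T` and `2` off `T`. -/
def lightOn {V : Type*} [DecidableEq V] (T : Finset V) (i : V) : ℕ := if i ∈ T then 1 else 2

theorem finite_Zlayer {V : Type*} [Finite V] {H : Finset (Finset V)} {f : ℕ → ℝ} (M j : ℕ) :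
    (Zlayer M j H f).Finite := by
  refine (Set.Finite.pi' fun _ : V => Set.finite_Icc 1 M).subset ?_
  intro w hw i
  exact hw.1.1 i

section

variable {V : Type*} [DecidableEq V] {H : Finset (Finset V)} {f : ℕ → ℝ}

theorem lightOn_injective : Function.Injective (lightOn : Finset V → V → ℕ) := by
  intro S T h
  ext i
  have hi := congrFun h i
  unfold lightOn at hi
  split_ifs at hi <;> simp_all

theorem edgeW_lightOn (f : ℕ → ℝ) (T e : Finset V) :
    edgeW f (lightOn T) e = f 2 * #e - (f 2 - f 1) * #(e ∩ T) := by
  have h : ∀ i, f (lightOn T i) = f 2 - (f 2 - f 1) * (if i ∈ T then 1 else 0) := by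
    intro i
    unfold lightOn
    split_ifs <;> simp
  simp only [edgeW, h, sum_sub_distrib, ← mul_sum, sum_const, nsmul_eq_mul, sum_boole,
    filter_mem_eq_inter]
  ring

theorem lightOn_mem_Zlayer {T : Finset V} (hT : T.Nonempty) (h : Isolating H f (lightOn T)) :
    lightOn T ∈ Zlayer 2 1 H f := by
  have hb : ∀ i, 1 ≤ lightOn T i ∧ lightOn T i ≤ 2 := by
    intro i
    unfold lightOn
    split_ifs <;> simp
  obtain ⟨i, hi⟩ := hT
  exact ⟨⟨hb, h⟩, fun j => (hb j).1, i, by simp [lightOn, hi]⟩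

theorem card_le_ncard_Zlayer [Fintype V] {P : V → Finset V → Prop}
    (hP : ∀ v, ∃ T, P v T ∧ T.Nonempty ∧ Isolating H f (lightOn T))
    (hinj : ∀ u v T, P u T → P v T → u = v) :
    Fintype.card V ≤ (Zlayer 2 1 H f).ncard := by
  choose φ hφ using hP
  have hφi : Function.Injective fun v => lightOn (φ v) := fun u v huv =>
    hinj u v (φ u) (hφ u).1 (lightOn_injective huv ▸ (hφ v).1)
  rw [← Nat.card_eq_fintype_card, ← Set.ncard_range_of_injective hφi]
  refine Set.ncard_le_ncard ?_ (finite_Zlayer 2 1)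
  rintro _ ⟨v, rfl⟩
  exact lightOn_mem_Zlayer (hφ v).2.1 (hφ v).2.2

theorem isolating_of_forall_lt {w : V → ℕ} {e : Finset V} (he : e ∈ H)
    (h : ∀ e' ∈ H, e' ≠ e → edgeW f w e < edgeW f w e') : Isolating H f w := by
  refine Or.inr ⟨e, ⟨he, h⟩, ?_⟩
  rintro e' ⟨he', h'⟩
  by_contra hne
  exact lt_asymm (h e' he' hne) (h' e he (Ne.symm hne))

/-- For an edge `e` of minimum size, being isolated by `lightOn T` is a matter of comparing
intersections with `T`, strictly only against the other edges of minimum size. -/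
theorem isolating_lightOn (hf : Objective 2 f) {e T : Finset V} (he : e ∈ H)
    (hmin : ∀ e' ∈ H, #e ≤ #e') (hle : ∀ e' ∈ H, #(e' ∩ T) ≤ #(e ∩ T))
    (hlt : ∀ e' ∈ H, e' ≠ e → #e' = #e → #(e' ∩ T) ≠ #(e ∩ T)) :
    Isolating H f (lightOn T) := by
  have h12 : f 1 < f 2 := hf.1 (by simp) (by simp) (by norm_num)
  have h2 : 0 < f 2 := hf.2 2 (by simp)
  refine isolating_of_forall_lt he fun e' he' hne => ?_
  rw [edgeW_lightOn, edgeW_lightOn]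
  have hI := hle e' he'
  rcases (hmin e' he').eq_or_lt with hc | hc
  · have : (#(e' ∩ T) : ℝ) < #(e ∩ T) := by
      exact_mod_cast lt_of_le_of_ne hI (hlt e' he' hne hc.symm)
    rw [hc]
    nlinarith
  · have h3 : (#(e' ∩ T) : ℝ) ≤ #(e ∩ T) := by exact_mod_cast hI
    have h4 : (#e : ℝ) < #e' := by exact_mod_cast hc
    nlinarith

theorem isolating_lightOn_self (hf : Objective 2 f) {e : Finset V} (he : e ∈ H)
    (hmin : ∀ e' ∈ H, #e ≤ #e') : Isolating H f (lightOn e) := by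
  refine isolating_lightOn hf he hmin ?_ ?_
  · intro e' _
    rw [inter_self]
    exact card_le_card inter_subset_right
  · intro e' _ hne hc h
    rw [inter_self] at h
    have h1 : e' ∩ e = e := eq_of_subset_of_card_le inter_subset_right h.ge
    exact hne (eq_of_subset_of_card_le (inter_eq_right.1 h1) hc.le).symm

/-- An edge that differs from the equally large set `e` by losing `v`. -/
theorem exists_eq_insert_erase {e e' : Finset V} {v : V} (hv : v ∈ e) (hne : e' ≠ e)
    (hc : #e' = #e) (hsub : e.erase v ⊆ e') : ∃ z ∉ e, e' = insert z (e.erase v) := by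
  have hlt : #(e.erase v) < #e' := hc ▸ card_erase_lt_of_mem hv
  obtain ⟨z, hz, hz'⟩ := exists_mem_notMem_of_card_lt_card hlt
  have heq : e' = insert z (e.erase v) := by
    refine (eq_of_subset_of_card_le (insert_subset hz hsub) ?_).symm
    rw [card_insert_of_notMem hz', card_erase_of_mem hv, hc]
    omega
  refine ⟨z, fun hze => hne ?_, heq⟩
  have hzv : z = v := by
    by_contra h
    exact hz' (mem_erase.2 ⟨h, hze⟩)
  rw [heq, hzv, insert_erase hv]

theorem isolating_lightOn_erase (hf : Objective 2 f) {e : Finset V} {v : V} (he : e ∈ H)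
    (hmin : ∀ e' ∈ H, #e ≤ #e') (hv : v ∈ e)
    (h : ∀ z ∉ e, insert z (e.erase v) ∉ H) : Isolating H f (lightOn (e.erase v)) := by
  have hI : e ∩ e.erase v = e.erase v := inter_eq_right.2 (erase_subset v e)
  refine isolating_lightOn hf he hmin ?_ ?_
  · intro e' _
    rw [hI]
    exact card_le_card inter_subset_right
  · intro e' he' hne hc hcard
    rw [hI] at hcard
    have hsub : e.erase v ⊆ e' :=
      inter_eq_right.1 (eq_of_subset_of_card_le inter_subset_right hcard.ge)
    obtain ⟨z, hz, rfl⟩ := exists_eq_insert_erase hv hne hc hsub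
    exact h z hz he'

theorem isolating_lightOn_insert (hf : Objective 2 f) (hH : InclFree H) {e : Finset V} {v : V}
    (he : e ∈ H) (hmin : ∀ e' ∈ H, #e ≤ #e') (hv : v ∉ e)
    (h : ∀ u ∈ e, insert v (e.erase u) ∉ H) : Isolating H f (lightOn (insert v e)) := by
  have hI : e ∩ insert v e = e := inter_eq_left.2 (subset_insert v e)
  have hcI := card_insert_of_notMem hv
  refine isolating_lightOn hf he hmin ?_ ?_
  · intro e' he'
    rw [hI]
    by_contra! hlt
    have h1 : e' ∩ insert v e = insert v e :=
      eq_of_subset_of_card_le inter_subset_right (by omega)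
    exact hH e he e' he' ((ssubset_insert hv).trans_subset (inter_eq_right.1 h1))
  · intro e' he' hne hc hcard
    rw [hI] at hcard
    have hsub : e' ⊆ insert v e :=
      inter_eq_left.1 (eq_of_subset_of_card_le inter_subset_left (by omega))
    obtain ⟨u, hu, hu'⟩ : ∃ u ∈ e, u ∉ e' := by
      by_contra! hall
      exact hne (eq_of_subset_of_card_le hall hc.le).symm
    have heq : e' = insert v (e.erase u) := by
      refine eq_of_subset_of_card_le (fun i hi => ?_) ?_
      · have := hsub hi
        have : i ≠ u := fun hiu => hu' (hiu ▸ hi)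
        simp_all
      · have hpos : 0 < #e := card_pos.2 ⟨u, hu⟩
        rw [card_insert_of_notMem (by simp [hv]), card_erase_of_mem hu]
        omega
    exact h u hu (heq ▸ he')

theorem card_le_of_no_neighbor [Fintype V] (hf : Objective 2 f) (hH : InclFree H)
    {e : Finset V} {x : V} (he : e ∈ H) (hmin : ∀ e' ∈ H, #e ≤ #e') (hx : x ∈ e)
    (h : ∀ u ∈ e, ∀ y ∉ e, insert y (e.erase u) ∉ H) :
    Fintype.card V ≤ (Zlayer 2 1 H f).ncard := by
  refine card_le_ncard_Zlayer
    (P := fun v T => (v = x → T = e) ∧ (v ≠ x → ∀ i, (i ∈ T ↔ i ∈ e) ↔ i ≠ v)) ?_ ?_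
  · intro v
    by_cases hvx : v = x
    · exact ⟨e, by simp [hvx], ⟨x, hx⟩, isolating_lightOn_self hf he hmin⟩
    by_cases hv : v ∈ e
    · refine ⟨e.erase v, ⟨fun h => absurd h hvx, fun _ i => ?_⟩,
        ⟨x, mem_erase.2 ⟨Ne.symm hvx, hx⟩⟩, isolating_lightOn_erase hf he hmin hv (h v hv)⟩
      grind
    · refine ⟨insert v e, ⟨fun h => absurd h hvx, fun _ i => ?_⟩, insert_nonempty v e,
        isolating_lightOn_insert hf hH he hmin hv fun u hu => h u hu v hv⟩
      grind
  · rintro u v T ⟨hu, hu'⟩ ⟨hv, hv'⟩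
    have hu1 := fun h => hu' h u
    have hv1 := fun h => hv' h v
    have huv := fun h => hu' h v
    clear h hmin hu' hv'
    by_contra hne
    by_cases hux : u = x <;> by_cases hvx : v = x <;> simp_all [eq_comm]

theorem card_le_of_neighbor [Fintype V] (hf : Objective 2 f) (hH : InclFree H)
    {e : Finset V} {x y : V} (he : e ∈ H) (hmin : ∀ e' ∈ H, #e ≤ #e') (hx : x ∈ e)
    (hy : y ∉ e) (hxy : insert y (e.erase x) ∈ H) :
    Fintype.card V ≤ (Zlayer 2 1 H f).ncard := by
  have hminc : ∀ u ∈ e, ∀ z ∉ e, ∀ e' ∈ H, #(insert z (e.erase u)) ≤ #e' := by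
    intro u hu z hz
    rw [card_insert_of_notMem (by simp [hz]), card_erase_add_one hu]
    exact hmin
  refine card_le_ncard_Zlayer
    (P := fun v T => (v = x → T = e) ∧ (v = y → T = insert y (e.erase x)) ∧
      (v ∉ e → v ∈ T ∧ ∀ i ∈ T, i ∉ e → i = v) ∧
      (v ∈ e → v ≠ x → y ∈ T ∧ v ∉ T ∧ ∀ u ∈ e, u ≠ x → u ≠ v → u ∈ T)) ?_ ?_
  · intro v
    by_cases hvx : v = x
    · exact ⟨e, by grind, ⟨x, hx⟩, isolating_lightOn_self hf he hmin⟩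
    by_cases hvy : v = y
    · exact ⟨_, by grind, insert_nonempty _ _, isolating_lightOn_self hf hxy (hminc x hx y hy)⟩
    by_cases hv : v ∈ e
    · by_cases hvy' : insert y (e.erase v) ∈ H
      · exact ⟨_, by grind, insert_nonempty _ _,
          isolating_lightOn_self hf hvy' (hminc v hv y hy)⟩
      have hv1 : v ∈ insert y (e.erase x) := by grind
      by_cases hz : ∃ z ∉ insert y (e.erase x), insert z ((insert y (e.erase x)).erase v) ∈ H
      · obtain ⟨z, hz, hzH⟩ := hz
        have hzx : z ≠ x := by
          rintro rfl
          refine hvy' ?_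
          convert hzH using 1
          grind
        refine ⟨_, by grind, insert_nonempty _ _, isolating_lightOn_self hf hzH ?_⟩
        rw [card_insert_of_notMem (by grind), card_erase_add_one hv1]
        exact hminc x hx y hy
      · push Not at hz
        exact ⟨_, by grind, ⟨y, by grind⟩,
          isolating_lightOn_erase hf hxy (hminc x hx y hy) hv1 hz⟩
    · by_cases hu : ∃ u ∈ e, insert v (e.erase u) ∈ H
      · obtain ⟨u, hu, huH⟩ := hu
        exact ⟨_, by grind, insert_nonempty _ _, isolating_lightOn_self hf huH (hminc u hu v hv)⟩
      · push Not at hu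
        exact ⟨_, by grind, insert_nonempty _ _, isolating_lightOn_insert hf hH he hmin hv hu⟩
  · rintro u v T ⟨hu1, hu2, hu3, hu4⟩ ⟨hv1, hv2, hv3, hv4⟩
    clear hminc hmin hxy he hf hH
    by_cases hu : u ∈ e <;> by_cases hv : v ∈ e <;>
      by_cases hux : u = x <;> by_cases hvx : v = x <;> grind

theorem card_le_of_forall_isolating [Fintype V]
    (h : ∀ T : Finset V, Isolating H f (lightOn T)) :
    Fintype.card V ≤ (Zlayer 2 1 H f).ncard :=
  card_le_ncard_Zlayer (P := fun v T => T = {v})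
    (fun v => ⟨{v}, rfl, singleton_nonempty v, h _⟩) (by simp)

theorem card_le_ncard_Zlayer_two_one [Fintype V] (hf : Objective 2 f) (hH : InclFree H) :
    Fintype.card V ≤ (Zlayer 2 1 H f).ncard := by
  rcases H.eq_empty_or_nonempty with h0 | hne
  · exact card_le_of_forall_isolating fun T => Or.inl h0
  obtain ⟨e, he, hmin⟩ := H.exists_min_image card hne
  rcases e.eq_empty_or_nonempty with rfl | ⟨x, hx⟩
  · refine card_le_of_forall_isolating fun T => isolating_of_forall_lt he fun e' he' hne' => ?_
    exact absurd (empty_ssubset.2 (nonempty_iff_ne_empty.2 hne')) (hH ∅ he e' he')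
  by_cases h : ∃ u ∈ e, ∃ y ∉ e, insert y (e.erase u) ∈ H
  · obtain ⟨u, hu, y, hy, huy⟩ := h
    exact card_le_of_neighbor hf hH he hmin hu hy huy
  · push Not at h
    exact card_le_of_no_neighbor hf hH he hmin hx h

end

/-- Corollary 19 of the paper: the case `M = 2`.  For every
`n ≥ 2`, every inclusion-free hypergraph `H` on `[n]`, and every objective function
`f : [2] → ℝ`, we have `|Z_1(H, 2, f)| ≥ n`. -/
theorem stmt_15 {n : ℕ} (hn : 2 ≤ n) (H : Finset (Finset (Fin n)))
    (hH : InclFree H) (f : ℕ → ℝ) (hf : Objective 2 f) :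
    n ≤ (Zlayer 2 1 H f).ncard := by
  simpa using card_le_ncard_Zlayer_two_one hf hH
end
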